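/- Let X be a compact Ptolemy space with the homothety property (H). Then for every ω ∈ X, every point z ∈ X_ω, and every Ptolemy line l ⊆ X_ω with z ∉ l and unit-speed parameterization c : ℝ → X_ω, the function t ↦ d(z, c(t)) is convex and continuously differentiable on ℝ. Consequently X is Busemann flat: for every Ptolemy line in X_ω with unit-speed parameterization c, the opposite Busemann functions b⁺(x) = lim_{t→∞}(d(x,c(t)) − t) and b⁻(x) = lim_{t→∞}(d(x,c(−t)) − t) satisfy b⁺(x) + b⁻(x) = 0 for all x ∈ X_ω. -/

import Mathlib

open scoped ENNReal

namespace Mobius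

/-- An extended metric on `X`, allowed to have (at most) one infinitely remote point,
which is recorded in the field `rem`.  Distances take values in `ℝ≥0∞`, and the value `⊤`
occurs exactly on pairs of distinct points one of which is the remote point. -/
structure ExtMetric (X : Type*) where
  d : X → X → ℝ≥0∞
  rem : Option X
  symm : ∀ x y, d x y = d y x
  d_self : ∀ x, d x x = 0
  pos : ∀ x y, x ≠ y → 0 < d x y
  triangle : ∀ x y z, d x z ≤ d x y + d y z
  d_eq_top_iff : ∀ x y, d x y = ⊤ ↔ (x ≠ y ∧ (rem = some x ∨ rem = some y))

/-- The finite factor of a distance used in cross-ratio triples: infinite factors are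
dropped (replaced by `1`), in accordance with the standard conventions for cross-ratio
triples of quadruples containing the infinitely remote point. -/
noncomputable def ExtMetric.fd {X : Type*} (d : ExtMetric X) (x y : X) : ℝ :=
  if d.d x y = ⊤ then 1 else (d.d x y).toReal

/-- A representative in `ℝ³` of the cross-ratio triple
`crt(x,y,z,u) = (d(x,y)d(z,u) : d(x,z)d(y,u) : d(x,u)d(y,z)) ∈ ℝP²`,
with the standard conventions when the infinitely remote point occurs among the points. -/
noncomputable def crtVec {X : Type*} (d : ExtMetric X) (x y z u : X) : ℝ × ℝ × ℝ :=
  (d.fd x y * d.fd z u, d.fd x z * d.fd y u, d.fd x u * d.fd y z)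

/-- A quadruple is admissible if no entry occurs three or four times in it. -/
def Admissible {X : Type*} (x y z u : X) : Prop :=
  ¬(x = y ∧ y = z) ∧ ¬(x = y ∧ y = u) ∧ ¬(x = z ∧ z = u) ∧ ¬(y = z ∧ z = u)

/-- Two vectors in `ℝ³` represent the same point of the projective plane (they are
positively proportional). -/
def ProjEq (v w : ℝ × ℝ × ℝ) : Prop :=
  ∃ lam : ℝ, 0 < lam ∧ w = lam • v

theorem ProjEq.refl (v : ℝ × ℝ × ℝ) : ProjEq v v :=
  ⟨1, one_pos, (one_smul ℝ v).symm⟩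

theorem ProjEq.symm {v w : ℝ × ℝ × ℝ} (h : ProjEq v w) : ProjEq w v := by
  obtain ⟨l, hl, rfl⟩ := h
  exact ⟨l⁻¹, inv_pos.mpr hl, by rw [smul_smul, inv_mul_cancel₀ hl.ne', one_smul]⟩

theorem ProjEq.trans' {v w u : ℝ × ℝ × ℝ} (h1 : ProjEq v w) (h2 : ProjEq v u) :
    ProjEq w u := by
  obtain ⟨l, hl, rfl⟩ := h1
  obtain ⟨m, hm, rfl⟩ := h2
  refine ⟨m * l⁻¹, by positivity, ?_⟩
  rw [smul_smul, mul_assoc, inv_mul_cancel₀ hl.ne', mul_one]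

/-- A Möbius structure on a set `X`: a (maximal) class of pairwise Möbius-equivalent
extended metrics on `X`, i.e. metrics defining the same cross-ratio triples on all
admissible quadruples. -/
structure MobiusStructure (X : Type*) where
  M : Set (ExtMetric X)
  nonempty : M.Nonempty
  compat : ∀ d ∈ M, ∀ d' ∈ M, ∀ x y z u : X, Admissible x y z u →
    ProjEq (crtVec d x y z u) (crtVec d' x y z u)
  maximal : ∀ d' : ExtMetric X,
    (∀ d ∈ M, ∀ x y z u : X, Admissible x y z u →
      ProjEq (crtVec d x y z u) (crtVec d' x y z u)) → d' ∈ M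

/-- The Möbius structure generated by a single extended metric. -/
def MobiusStructure.ofMetric {X : Type*} (d₀ : ExtMetric X) : MobiusStructure X where
  M := {d | ∀ x y z u : X, Admissible x y z u →
    ProjEq (crtVec d₀ x y z u) (crtVec d x y z u)}
  nonempty := ⟨d₀, fun _ _ _ _ _ => ProjEq.refl _⟩
  compat := fun _ hd _ hd' x y z u ha => (hd x y z u ha).trans' (hd' x y z u ha)
  maximal := fun _ h => h d₀ (fun _ _ _ _ _ => ProjEq.refl _)

/-- A Möbius structure is Ptolemy if the entries of every cross-ratio triple of every
admissible quadruple satisfy the triangle inequality. -/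
def IsPtolemyStructure {X : Type*} (S : MobiusStructure X) : Prop :=
  ∀ d ∈ S.M, ∀ x y z u : X, Admissible x y z u →
    (crtVec d x y z u).1 ≤ (crtVec d x y z u).2.1 + (crtVec d x y z u).2.2 ∧
    (crtVec d x y z u).2.1 ≤ (crtVec d x y z u).1 + (crtVec d x y z u).2.2 ∧
    (crtVec d x y z u).2.2 ≤ (crtVec d x y z u).1 + (crtVec d x y z u).2.1

/-- The topology of a Möbius space: generated by the open balls of the metrics of the
structure (centered at points distinct from the respective remote points) together with
the complements of the closed balls. -/
def mobiusTop {X : Type*} (S : MobiusStructure X) : TopologicalSpace X :=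
  TopologicalSpace.generateFrom
    {s | ∃ d ∈ S.M, ∃ x : X, d.rem ≠ some x ∧ ∃ r : ℝ≥0∞, 0 < r ∧ r ≠ ⊤ ∧
      (s = {y | d.d y x < r} ∨ s = {y | r < d.d y x})}

/-- Connected components of subsets with respect to the Möbius topology. -/
def mobiusCCIn {X : Type*} (S : MobiusStructure X) (F : Set X) (x : X) : Set X :=
  @connectedComponentIn X (mobiusTop S) F x

/-- The pair `(x,z)` separates the pair `(y,u)` in `σ`:  `y` and `u` lie in different
connected components of `σ \ {x,z}`. -/
def SeparatesIn {X : Type*} (S : MobiusStructure X) (σ : Set X) (x z y u : X) : Prop :=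
  u ∉ mobiusCCIn S (σ \ {x, z}) y

/-- `σ` is homeomorphic to the circle `S¹` (with respect to the Möbius topology). -/
def HomeoToCircle {X : Type*} (S : MobiusStructure X) (σ : Set X) : Prop :=
  letI : TopologicalSpace X := mobiusTop S
  Nonempty (σ ≃ₜ Metric.sphere (0 : ℂ) 1)

/-- `X` is homeomorphic to the sphere `Sⁿ ⊆ ℝ^{n+1}` (w.r.t. the Möbius topology). -/
def HomeoToSphere {X : Type*} (S : MobiusStructure X) (n : ℕ) : Prop :=
  letI : TopologicalSpace X := mobiusTop S
  Nonempty (X ≃ₜ Metric.sphere (0 : EuclideanSpace ℝ (Fin (n + 1))) 1)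

/-- The subset `A ⊆ X` is homeomorphic to `ℝᵖ` (w.r.t. the Möbius topology). -/
def SubsetHomeoToEuclidean {X : Type*} (S : MobiusStructure X) (A : Set X) (p : ℕ) : Prop :=
  letI : TopologicalSpace X := mobiusTop S
  Nonempty (A ≃ₜ EuclideanSpace ℝ (Fin p))

/-- The subset `A ⊆ X` is homeomorphic to `ℝ` (w.r.t. the Möbius topology). -/
def SubsetHomeoToReal {X : Type*} (S : MobiusStructure X) (A : Set X) : Prop :=
  letI : TopologicalSpace X := mobiusTop S
  Nonempty (A ≃ₜ ℝ)

/-- A Ptolemy circle: a subset homeomorphic to `S¹` on which the Ptolemy equality holds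
for every quadruple of distinct points `(x,y,z,u)` such that `(x,z)` separates `(y,u)`. -/
def IsPtolemyCircle {X : Type*} (S : MobiusStructure X) (σ : Set X) : Prop :=
  HomeoToCircle S σ ∧
  ∀ d ∈ S.M, ∀ x ∈ σ, ∀ y ∈ σ, ∀ z ∈ σ, ∀ u ∈ σ,
    x ≠ y → x ≠ z → x ≠ u → y ≠ z → y ≠ u → z ≠ u →
    SeparatesIn S σ x z y u →
    d.d x z * d.d y u = d.d x y * d.d z u + d.d x u * d.d y z

/-- A Möbius automorphism of `X`: a bijection preserving all cross-ratio triples. -/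
def IsMobiusAuto {X : Type*} (S : MobiusStructure X) (f : X → X) : Prop :=
  Function.Bijective f ∧ ∀ d ∈ S.M, ∀ x y z u : X, Admissible x y z u →
    ProjEq (crtVec d x y z u) (crtVec d (f x) (f y) (f z) (f u))

/-- A metric sphere between two distinct points `ω`, `ω'`. -/
def IsMetricSphere {X : Type*} (S : MobiusStructure X) (ω ω' : X) (Sp : Set X) : Prop :=
  ∃ d ∈ S.M, d.rem = some ω' ∧ ∃ r : ℝ≥0∞, 0 < r ∧ r ≠ ⊤ ∧ Sp = {x | d.d x ω = r}

/-- A space inversion with respect to `ω`, `ω'` and a metric sphere `Sp` between them. -/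
def IsSpaceInversion {X : Type*} (S : MobiusStructure X) (ω ω' : X) (Sp : Set X)
    (φ : X → X) : Prop :=
  IsMobiusAuto S φ ∧ Function.Involutive φ ∧ (∀ x, φ x ≠ x) ∧ φ ω = ω' ∧
  φ '' Sp = Sp ∧ ∀ σ : Set X, IsPtolemyCircle S σ → ω ∈ σ → ω' ∈ σ → φ '' σ = σ

/-- Property (E): existence of at least one Ptolemy circle. -/
def PropertyE {X : Type*} (S : MobiusStructure X) : Prop :=
  ∃ σ : Set X, IsPtolemyCircle S σ

/-- Property (I): existence and uniqueness of space inversions. -/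
def PropertyI {X : Type*} (S : MobiusStructure X) : Prop :=
  ∀ ω ω' : X, ω ≠ ω' → ∀ Sp : Set X, IsMetricSphere S ω ω' Sp →
    ∃! φ : X → X, IsSpaceInversion S ω ω' Sp φ

/-- The Möbius space is compact. -/
def MobiusCompact {X : Type*} (S : MobiusStructure X) : Prop :=
  letI : TopologicalSpace X := mobiusTop S
  CompactSpace X

/-- Property (H), the homothety property. -/
def PropertyH {X : Type*} (S : MobiusStructure X) : Prop :=
  ∀ ω ω' : X, ω ≠ ω' → ∀ σ : Set X, IsPtolemyCircle S σ → ω ∈ σ → ω' ∈ σ →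
    ∀ x x' : X, x ∈ σ \ {ω, ω'} → x' ∈ mobiusCCIn S (σ \ {ω, ω'}) x →
    ∃ γ : X → X, IsMobiusAuto S γ ∧ γ ω = ω ∧ γ ω' = ω' ∧
      (∀ σ' : Set X, IsPtolemyCircle S σ' → ω ∈ σ' → ω' ∈ σ' →
        γ '' σ' = σ' ∧ ∀ y ∈ σ' \ {ω, ω'}, γ y ∈ mobiusCCIn S (σ' \ {ω, ω'}) y) ∧
      γ x = x'

/-- A Ptolemy line in `X_ω`: a Ptolemy circle through `ω` with `ω` removed. -/
def IsPtolemyLine {X : Type*} (S : MobiusStructure X) (ω : X) (l : Set X) : Prop :=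
  ∃ σ : Set X, IsPtolemyCircle S σ ∧ ω ∈ σ ∧ l = σ \ {ω}

/-- `c : ℝ → X` is a unit-speed parameterization of `l ⊆ X` w.r.t. the metric `d`. -/
def IsUnitSpeed {X : Type*} (d : ExtMetric X) (l : Set X) (c : ℝ → X) : Prop :=
  Set.range c = l ∧ ∀ s t : ℝ, d.d (c s) (c t) = ENNReal.ofReal |s - t|

/-- `b` is a Busemann function of the Ptolemy line `l ⊆ X_ω`:  up to an additive constant,
`b x = lim_{t→∞} (d(x,c(t)) − t)` for a unit-speed parameterization `c` of `l`. -/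
def IsBusemannOf {X : Type*} (S : MobiusStructure X) (d : ExtMetric X) (ω : X)
    (l : Set X) (b : X → ℝ) : Prop :=
  IsPtolemyLine S ω l ∧ ∃ c : ℝ → X, IsUnitSpeed d l c ∧ ∃ C : ℝ, ∀ x : X, x ≠ ω →
    Filter.Tendsto (fun t => (d.d x (c t)).toReal - t) Filter.atTop (nhds (b x + C))

/-- The fiber through `x` of the canonical fibration `π_ω`: the set of points on which
every Busemann function of every Ptolemy line of `X_ω` takes the same value as at `x`. -/
def mobiusFiber {X : Type*} (S : MobiusStructure X) (d : ExtMetric X) (ω : X) (x : X) :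
    Set X :=
  {y | y ≠ ω ∧ ∀ (l : Set X) (b : X → ℝ), IsBusemannOf S d ω l b → b y = b x}

/-- The base `B_ω` of the canonical fibration: the set of all fibers. -/
def mobiusBase {X : Type*} (S : MobiusStructure X) (d : ExtMetric X) (ω : X) :
    Set (Set X) :=
  {F | ∃ x : X, x ≠ ω ∧ F = mobiusFiber S d ω x}

/-- The distance between two fibers. -/
noncomputable def fiberDist {X : Type*} (d : ExtMetric X) (F F' : Set X) : ℝ :=
  sInf {r : ℝ | ∃ x ∈ F, ∃ x' ∈ F', r = (d.d x x').toReal}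

/-- Two Möbius spaces are Möbius equivalent: there is a bijection between them
preserving all cross-ratio triples. -/
def MobiusEquiv {X Y : Type*} (S : MobiusStructure X) (S' : MobiusStructure Y) : Prop :=
  ∃ f : X → Y, Function.Bijective f ∧ ∀ d ∈ S.M, ∀ d' ∈ S'.M, ∀ x y z u : X,
    Admissible x y z u → ProjEq (crtVec d x y z u) (crtVec d' (f x) (f y) (f z) (f u))

/-- The standard extended Euclidean metric on the one-point extension
`ℝ̂ⁿ = ℝⁿ ∪ {∞}`, where `∞` is encoded by `none`. -/
noncomputable def stdExtMetric (n : ℕ) : ExtMetric (Option (EuclideanSpace ℝ (Fin n))) where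
  d x y :=
    match x, y with
    | none, none => 0
    | none, some _ => ⊤
    | some _, none => ⊤
    | some a, some b => ENNReal.ofReal (dist a b)
  rem := some none
  symm := by intro x y; cases x <;> cases y <;> simp [dist_comm]
  d_self := by intro x; cases x <;> simp
  pos := by
    intro x y h
    cases x <;> cases y
    · exact absurd rfl h
    · simp
    · simp
    · simp only [ne_eq, Option.some.injEq] at h
      exact ENNReal.ofReal_pos.mpr (dist_pos.mpr h)
  triangle := by
    intro x y z
    cases x <;> cases y <;> cases z <;>
      simp only [le_refl, le_top, zero_le, zero_add, add_zero, top_add, add_top,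
        top_le_iff]
    rw [← ENNReal.ofReal_add dist_nonneg dist_nonneg]
    exact ENNReal.ofReal_le_ofReal (dist_triangle _ _ _)
  d_eq_top_iff := by
    intro x y
    cases x <;> cases y <;>
      simp [ENNReal.ofReal_ne_top]


section FiniteDistances

variable {X : Type*} {S : MobiusStructure X} {d d' : ExtMetric X} {ω : X}

theorem ExtMetric.ne_top_of_ne_rem (hrem : d.rem = some ω) {x y : X} (hx : x ≠ ω)
    (hy : y ≠ ω) : d.d x y ≠ ⊤ := by
  intro h
  have := ((d.d_eq_top_iff x y).1 h).2
  rw [hrem] at this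
  simp only [Option.some.injEq] at this
  rcases this with rfl | rfl <;> contradiction

theorem ExtMetric.fd_eq_toReal {x y : X} (h : d.d x y ≠ ⊤) :
    d.fd x y = (d.d x y).toReal := if_neg h

theorem ExtMetric.ofReal_fd {x y : X} (h : d.d x y ≠ ⊤) :
    ENNReal.ofReal (d.fd x y) = d.d x y := by
  rw [fd_eq_toReal h, ENNReal.ofReal_toReal h]

theorem ExtMetric.fd_comm (d : ExtMetric X) (x y : X) : d.fd x y = d.fd y x := by
  simp only [fd, d.symm x y]

theorem ExtMetric.fd_self (d : ExtMetric X) (x : X) : d.fd x x = 0 := by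
  simp [fd, d.d_self]

theorem ExtMetric.fd_nonneg (d : ExtMetric X) (x y : X) : 0 ≤ d.fd x y := by
  unfold fd
  split_ifs
  · exact zero_le_one
  · exact ENNReal.toReal_nonneg

theorem ExtMetric.fd_pos (d : ExtMetric X) {x y : X} (h : x ≠ y) : 0 < d.fd x y := by
  unfold fd
  split_ifs with htop
  · exact one_pos
  · exact ENNReal.toReal_pos (d.pos x y h).ne' htop

theorem ExtMetric.fd_rem (hrem : d.rem = some ω) {x : X} (hx : x ≠ ω) : d.fd x ω = 1 :=
  if_pos ((d.d_eq_top_iff x ω).2 ⟨hx, Or.inr hrem⟩)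

theorem ExtMetric.fd_triangle (hrem : d.rem = some ω) {x y z : X} (hx : x ≠ ω) (hy : y ≠ ω)
    (hz : z ≠ ω) : d.fd x z ≤ d.fd x y + d.fd y z := by
  have hxy := ne_top_of_ne_rem hrem hx hy
  have hyz := ne_top_of_ne_rem hrem hy hz
  rw [fd_eq_toReal hxy, fd_eq_toReal hyz, fd_eq_toReal (ne_top_of_ne_rem hrem hx hz),
    ← ENNReal.toReal_add hxy hyz]
  exact ENNReal.toReal_mono (ENNReal.add_ne_top.2 ⟨hxy, hyz⟩) (d.triangle x y z)

theorem IsPtolemyStructure.fd_mul_le (hpt : IsPtolemyStructure S) (hd : d ∈ S.M) {x y u v : X}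
    (hxu : x ≠ u) (hyu : y ≠ u) (hyv : y ≠ v) :
    d.fd x y * d.fd u v ≤ d.fd x u * d.fd y v + d.fd x v * d.fd y u ∧
    d.fd x u * d.fd y v ≤ d.fd x y * d.fd u v + d.fd x v * d.fd y u := by
  have h := hpt d hd x y u v ⟨fun h => hyu h.2, fun h => hyv h.2, fun h => hxu h.1,
    fun h => hyu h.1⟩
  exact ⟨h.1, h.2.1⟩

/-- Two metrics of a Möbius structure differ by an inversion factor. -/
theorem MobiusStructure.exists_fd_eq (hd : d ∈ S.M) (hd' : d' ∈ S.M) (hrem : d.rem = some ω) :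
    ∃ k : ℝ, 0 < k ∧ ∀ x y : X, x ≠ ω → y ≠ ω →
      d'.fd x y = k * d'.fd x ω * d'.fd y ω * d.fd x y := by
  by_cases h : ∃ p q : X, p ≠ ω ∧ q ≠ ω ∧ p ≠ q
  swap
  · refine ⟨1, one_pos, fun x y hx hy => ?_⟩
    have hxy : x = y := by
      by_contra hne
      exact h ⟨x, y, hx, hy, hne⟩
    rw [hxy, d.fd_self, d'.fd_self, mul_zero]
  obtain ⟨p, q, hp, hq, hpq⟩ := h
  let R : X → X → ℝ := fun x y => d'.fd x y / (d'.fd x ω * d'.fd y ω * d.fd x y)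
  have hsymm : ∀ x y, R x y = R y x := fun x y => by
    simp only [R]
    rw [d.fd_comm x y, d'.fd_comm x y, mul_comm (d'.fd x ω)]
  have key : ∀ x y z, x ≠ ω → y ≠ ω → z ≠ ω → x ≠ y → x ≠ z → R x y = R x z := by
    intro x y z hx hy hz hxy hxz
    obtain ⟨l, hl, h⟩ := S.compat d hd d' hd' x y z ω
      ⟨fun h => hxy h.1, fun h => hxy h.1, fun h => hxz h.1, fun h => hz h.2⟩
    have h1 := congrArg Prod.fst h
    have h2 := congrArg (fun v => v.2.1) h
    simp only [crtVec, Prod.smul_fst, Prod.smul_snd, smul_eq_mul, ExtMetric.fd_rem hrem hz,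
      ExtMetric.fd_rem hrem hy, mul_one] at h1 h2
    have hne := (d.fd_pos hxy).ne'
    have hne' := (d.fd_pos hxz).ne'
    have hx' := (d'.fd_pos hx).ne'
    have hy' := (d'.fd_pos hy).ne'
    have hz' := (d'.fd_pos hz).ne'
    simp only [R]
    rw [div_eq_div_iff (by positivity) (by positivity)]
    linear_combination (d'.fd x ω * d.fd x z) * h1
      - (d'.fd x ω * d.fd x y) * h2
  have hR : ∀ x y, x ≠ ω → y ≠ ω → x ≠ y → R x y = R p q := by
    intro x y hx hy hxy
    by_cases hxp : x = p
    · subst hxp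
      exact key x y q hx hy hq hxy hpq
    · rw [key x y p hx hy hp hxy hxp, hsymm x p, key p x q hp hx hq (Ne.symm hxp) hpq]
  refine ⟨R p q, div_pos (d'.fd_pos hpq) (mul_pos (mul_pos (d'.fd_pos hp) (d'.fd_pos hq))
    (d.fd_pos hpq)), fun x y hx hy => ?_⟩
  by_cases hxy : x = y
  · rw [hxy, d.fd_self, d'.fd_self, mul_zero]
  · rw [← hR x y hx hy hxy]
    have hne := (d.fd_pos hxy).ne'
    have hx' := (d'.fd_pos hx).ne'
    have hy' := (d'.fd_pos hy).ne'
    simp only [R]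
    field_simp

/-- The pullback of an extended metric by a bijection. -/
def ExtMetric.comap (d : ExtMetric X) (γ : X ≃ X) : ExtMetric X where
  d x y := d.d (γ x) (γ y)
  rem := d.rem.map γ.symm
  symm x y := d.symm _ _
  d_self x := d.d_self _
  pos x y h := d.pos _ _ (γ.injective.ne h)
  triangle x y z := d.triangle _ _ _
  d_eq_top_iff x y := by
    rw [d.d_eq_top_iff, γ.injective.ne_iff]
    cases d.rem with
    | none => simp
    | some a => simp [Equiv.symm_apply_eq]

theorem ExtMetric.fd_comap (d : ExtMetric X) (γ : X ≃ X) (x y : X) :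
    (d.comap γ).fd x y = d.fd (γ x) (γ y) := rfl

theorem IsMobiusAuto.comap_mem {γ : X ≃ X} (hγ : IsMobiusAuto S γ) (hd : d ∈ S.M) :
    d.comap γ ∈ S.M :=
  S.maximal _ fun d₀ hd₀ x y z u ha =>
    ((S.compat d₀ hd₀ d hd x y z u ha).symm).trans' (hγ.2 d hd x y z u ha)

end FiniteDistances

section RealConvexity

theorem contDiff_one_of_convexOn {f : ℝ → ℝ} (hf : ConvexOn ℝ Set.univ f)
    (hd : Differentiable ℝ f) : ContDiff ℝ 1 f := by
  rw [contDiff_one_iff_deriv]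
  refine ⟨hd, ?_⟩
  have hmono : Monotone (deriv f) := by
    rw [← monotoneOn_univ]
    exact hf.monotoneOn_deriv fun x _ => hd x
  have hoc : (Set.range (deriv f)).OrdConnected := by
    rw [← Set.image_univ]
    exact Set.ordConnected_univ.image_hasDerivWithinAt
      fun x _ => (hd x).hasDerivAt.hasDerivWithinAt
  have : Continuous (Set.rangeFactorization (deriv f)) :=
    Monotone.continuous_of_surjective (fun x y h => hmono h) Set.rangeFactorization_surjective
  exact continuous_subtype_val.comp this

/-- At a point where it is not differentiable, a convex function has a corner. -/
theorem exists_corner_of_convexOn {f : ℝ → ℝ} (hf : ConvexOn ℝ Set.univ f)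
    (hlip : ∀ s t, f s - f t ≤ |s - t|) {a : ℝ} (ha : ¬ DifferentiableAt ℝ f a) :
    ∃ α β : ℝ, β < α ∧ α ≤ 1 ∧ -1 ≤ β ∧ (∀ v, 0 ≤ v → f a + α * v ≤ f (a + v)) ∧
      ∀ v, 0 ≤ v → f a - β * v ≤ f (a - v) := by
  have hint : a ∈ interior (Set.univ : Set ℝ) := by simp
  have hr := hf.hasDerivWithinAt_rightDeriv_of_mem_interior hint
  have hl := hf.hasDerivWithinAt_leftDeriv_of_mem_interior hint
  have hle := hf.leftDeriv_le_rightDeriv_of_mem_interior hint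
  set α := derivWithin f (Set.Ioi a) a
  set β := derivWithin f (Set.Iio a) a
  have hne : β ≠ α := by
    intro h
    rw [h] at hl
    have := (hl.Iic_of_Iio.union hr.Ici_of_Ioi)
    rw [Set.Iic_union_Ici, hasDerivWithinAt_univ] at this
    exact ha this.differentiableAt
  have hα : ∀ v, 0 < v → f a + α * v ≤ f (a + v) := by
    intro v hv
    have := hf.rightDeriv_le_slope_of_mem_interior hint (Set.mem_univ (a + v)) (by linarith)
    rw [slope_def_field, le_div_iff₀ (by linarith)] at this
    linarith
  have hβ : ∀ v, 0 < v → f a - β * v ≤ f (a - v) := by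
    intro v hv
    have := hf.slope_le_leftDeriv_of_mem_interior (Set.mem_univ (a - v)) hint (by linarith)
    rw [slope_def_field, div_le_iff₀ (by linarith)] at this
    linarith
  refine ⟨α, β, lt_of_le_of_ne hle hne, ?_, ?_, fun v hv => ?_, fun v hv => ?_⟩
  · have h1 := hα 1 one_pos
    have h2 := hlip (a + 1) a
    rw [add_sub_cancel_left, abs_one] at h2
    linarith
  · have h1 := hβ 1 one_pos
    have h2 := hlip (a - 1) a
    rw [sub_sub_cancel_left, abs_neg, abs_one] at h2
    linarith
  · rcases hv.eq_or_lt with rfl | hv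
    · simp
    · exact hα v hv
  · rcases hv.eq_or_lt with rfl | hv
    · simp
    · exact hβ v hv

end RealConvexity

section Topology

variable {X : Type*} {S : MobiusStructure X} {d : ExtMetric X} {ω : X}

theorem isOpen_ball (hd : d ∈ S.M) {x : X} (hx : d.rem ≠ some x) {r : ℝ≥0∞} (hr : 0 < r)
    (hr' : r ≠ ⊤) : @IsOpen X (mobiusTop S) {y | d.d y x < r} :=
  TopologicalSpace.isOpen_generateFrom_of_mem ⟨d, hd, x, hx, r, hr, hr', Or.inl rfl⟩

theorem isOpen_compl_closedBall (hd : d ∈ S.M) {x : X} (hx : d.rem ≠ some x) {r : ℝ≥0∞}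
    (hr : 0 < r) (hr' : r ≠ ⊤) : @IsOpen X (mobiusTop S) {y | r < d.d y x} :=
  TopologicalSpace.isOpen_generateFrom_of_mem ⟨d, hd, x, hx, r, hr, hr', Or.inr rfl⟩

theorem ExtMetric.rem_ne_some (hrem : d.rem = some ω) {x : X} (hx : x ≠ ω) :
    d.rem ≠ some x := by
  rw [hrem]
  exact fun h => hx (Option.some.inj h).symm

theorem tendsto_of_tendsto_dist_zero (hcomp : MobiusCompact S) (hd : d ∈ S.M)
    {p : X} (hp : d.rem ≠ some p) {ι : Type*} {F : Filter ι} {g : ι → X}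
    (hg : Filter.Tendsto (fun i => d.d (g i) p) F (nhds 0)) :
    Filter.Tendsto g F (@nhds X (mobiusTop S) p) := by
  let _ : TopologicalSpace X := mobiusTop S
  have _ : CompactSpace X := hcomp
  refine le_nhds_of_unique_clusterPt fun w hw => ?_
  by_contra hne
  obtain ⟨r, hr0, hr⟩ := exists_between (d.pos w p hne)
  have hfar := hw.frequently ((isOpen_compl_closedBall hd hp hr0 hr.ne_top).mem_nhds hr)
  have hnear : ∀ᶠ i in F, d.d (g i) p < r := hg.eventually (gt_mem_nhds hr0)
  obtain ⟨i, hi, hi'⟩ := ((Filter.frequently_map.1 hfar).and_eventually hnear).exists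
  exact lt_asymm hi hi'

theorem tendsto_rem_of_tendsto_dist_top (hcomp : MobiusCompact S) (hd : d ∈ S.M)
    (hrem : d.rem = some ω) {p : X} (hp : p ≠ ω) {ι : Type*} {F : Filter ι} {g : ι → X}
    (hg : Filter.Tendsto (fun i => d.d (g i) p) F (nhds ⊤)) :
    Filter.Tendsto g F (@nhds X (mobiusTop S) ω) := by
  let _ : TopologicalSpace X := mobiusTop S
  have _ : CompactSpace X := hcomp
  refine le_nhds_of_unique_clusterPt fun w hw => ?_
  by_contra hne
  obtain ⟨r, hr, hrt⟩ := exists_between (ExtMetric.ne_top_of_ne_rem hrem hne hp).lt_top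
  have hnear := hw.frequently ((isOpen_ball hd (ExtMetric.rem_ne_some hrem hp)
    (bot_le.trans_lt hr) hrt.ne).mem_nhds hr)
  have hfar : ∀ᶠ i in F, r < d.d (g i) p := hg.eventually (lt_mem_nhds hrt)
  obtain ⟨i, hi, hi'⟩ := ((Filter.frequently_map.1 hnear).and_eventually hfar).exists
  exact lt_asymm hi hi'

/-- A bounded sequence of `X_ω` has two members at an arbitrarily small distance. -/
theorem exists_lt_dist_lt (hcomp : MobiusCompact S) (hd : d ∈ S.M) (hrem : d.rem = some ω)
    {p : ℕ → X} {q : X} (hq : q ≠ ω) {R : ℝ≥0∞} (hR : R ≠ ⊤) (hb : ∀ n, d.d (p n) q ≤ R)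
    {δ : ℝ≥0∞} (hδ : 0 < δ) (hδ' : δ ≠ ⊤) : ∃ m n, m < n ∧ d.d (p m) (p n) < δ := by
  let _ : TopologicalSpace X := mobiusTop S
  have _ : CompactSpace X := hcomp
  obtain ⟨w, hw⟩ := exists_clusterPt_of_compactSpace (Filter.map p Filter.atTop)
  have hwω : w ≠ ω := by
    rintro rfl
    have hfar := hw.frequently ((isOpen_compl_closedBall hd (ExtMetric.rem_ne_some hrem hq)
      (r := R + 1) (by simp) (ENNReal.add_ne_top.2 ⟨hR, ENNReal.one_ne_top⟩)).mem_nhds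
      (by
        have : d.d w q = ⊤ := (d.d_eq_top_iff w q).2 ⟨hq.symm, Or.inl hrem⟩
        simp only [Set.mem_ofPred_eq, this]
        exact (ENNReal.add_ne_top.2 ⟨hR, ENNReal.one_ne_top⟩).lt_top))
    obtain ⟨n, hn⟩ := Filter.Frequently.exists (Filter.frequently_map.1 hfar)
    exact (hb n).not_gt (lt_of_le_of_lt le_self_add hn)
  have hδ2 : 0 < δ / 2 := ENNReal.half_pos hδ.ne'
  have hnear := Filter.frequently_map.1 (hw.frequently ((isOpen_ball hd
    (ExtMetric.rem_ne_some hrem hwω) hδ2 (ENNReal.div_ne_top hδ' (by simp))).mem_nhds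
    (by simpa [d.d_self] using hδ.ne')))
  obtain ⟨m, -, hm⟩ := Filter.frequently_atTop.1 hnear 0
  obtain ⟨n, hmn, hn⟩ := Filter.frequently_atTop.1 hnear (m + 1)
  refine ⟨m, n, hmn, (d.triangle _ w _).trans_lt ?_⟩
  rw [← ENNReal.add_halves δ, d.symm w]
  exact ENNReal.add_lt_add hm hn

end Topology

section Lines

variable {X : Type*} {S : MobiusStructure X} {d : ExtMetric X} {ω : X} {σ : Set X} {c : ℝ → X}

theorem IsUnitSpeed.mem (hc : IsUnitSpeed d (σ \ {ω}) c) (t : ℝ) : c t ∈ σ :=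
  (hc.1.subset (Set.mem_range_self t)).1

theorem IsUnitSpeed.ne (hc : IsUnitSpeed d (σ \ {ω}) c) (t : ℝ) : c t ≠ ω :=
  (hc.1.subset (Set.mem_range_self t)).2

theorem IsUnitSpeed.exists_eq (hc : IsUnitSpeed d (σ \ {ω}) c) {x : X} (hx : x ∈ σ)
    (hxω : x ≠ ω) : ∃ t, c t = x :=
  hc.1.superset ⟨hx, hxω⟩

theorem IsUnitSpeed.injective {l : Set X} (hc : IsUnitSpeed d l c) : Function.Injective c := by
  intro s t h
  have := hc.2 s t
  rw [h, d.d_self, eq_comm, ENNReal.ofReal_eq_zero] at this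
  exact sub_eq_zero.1 (abs_nonpos_iff.1 this)

theorem IsUnitSpeed.fd_eq {l : Set X} (hc : IsUnitSpeed d l c) (s t : ℝ) :
    d.fd (c s) (c t) = |s - t| := by
  rw [ExtMetric.fd_eq_toReal (by rw [hc.2]; exact ENNReal.ofReal_ne_top), hc.2,
    ENNReal.toReal_ofReal (abs_nonneg _)]

theorem IsUnitSpeed.continuous (hcomp : MobiusCompact S) (hd : d ∈ S.M)
    (hrem : d.rem = some ω) (hc : IsUnitSpeed d (σ \ {ω}) c) :
    @Continuous ℝ X _ (mobiusTop S) c := by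
  let _ : TopologicalSpace X := mobiusTop S
  rw [continuous_iff_continuousAt]
  intro t
  refine tendsto_of_tendsto_dist_zero hcomp hd (ExtMetric.rem_ne_some hrem (hc.ne t)) ?_
  have : Continuous fun s : ℝ => ENNReal.ofReal |s - t| :=
    ENNReal.continuous_ofReal.comp (by fun_prop)
  simpa [hc.2] using this.tendsto t

/-- On a ray of a Ptolemy line issuing from `c q`, all points are in the same component
of the complement of `c q`. -/
theorem IsUnitSpeed.mem_mobiusCCIn (hcomp : MobiusCompact S) (hd : d ∈ S.M)
    (hrem : d.rem = some ω) (hc : IsUnitSpeed d (σ \ {ω}) c) {q s t : ℝ} (hs : s < q)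
    (ht : t < q) : c t ∈ mobiusCCIn S (σ \ {ω, c q}) (c s) := by
  let _ : TopologicalSpace X := mobiusTop S
  have hpre : IsPreconnected (c '' Set.Iio q) :=
    isPreconnected_Iio.image _ (hc.continuous hcomp hd hrem).continuousOn
  refine hpre.subset_connectedComponentIn ⟨s, hs, rfl⟩ ?_ ⟨t, ht, rfl⟩
  rintro _ ⟨r, hr, rfl⟩
  refine ⟨hc.mem r, ?_⟩
  rintro (h | h)
  · exact hc.ne r h
  · exact (ne_of_lt hr) (hc.injective h)

/-- The ends of a Ptolemy line are joined by the remote point. -/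
theorem IsUnitSpeed.mem_mobiusCCIn_rem (hcomp : MobiusCompact S) (hd : d ∈ S.M)
    (hrem : d.rem = some ω) (hωσ : ω ∈ σ) (hc : IsUnitSpeed d (σ \ {ω}) c) {p q t : ℝ}
    (hp : p < t) (hq : q < t) :
    c t ∈ mobiusCCIn S (σ \ {c p, c q}) ω := by
  let _ : TopologicalSpace X := mobiusTop S
  have hpre : IsPreconnected (c '' Set.Ici t) :=
    isPreconnected_Ici.image _ (hc.continuous hcomp hd hrem).continuousOn
  have hlim : Filter.Tendsto c Filter.atTop (nhds ω) := by
    refine tendsto_rem_of_tendsto_dist_top hcomp hd hrem (hc.ne 0) ?_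
    simp only [hc.2, sub_zero]
    exact ENNReal.tendsto_ofReal_nhds_top.2 Filter.tendsto_abs_atTop_atTop
  have hcl : ω ∈ closure (c '' Set.Ici t) :=
    mem_closure_of_tendsto hlim ((Filter.eventually_ge_atTop t).mono fun s hs => ⟨s, hs, rfl⟩)
  have hpre' : IsPreconnected (insert ω (c '' Set.Ici t)) :=
    hpre.subset_closure (Set.subset_insert _ _) (Set.insert_subset hcl subset_closure)
  refine hpre'.subset_connectedComponentIn (Set.mem_insert _ _) ?_
    (Set.mem_insert_of_mem _ ⟨t, Set.self_mem_Ici, rfl⟩)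
  rintro _ (rfl | ⟨r, hr, rfl⟩)
  · refine ⟨hωσ, ?_⟩
    rintro (h | h)
    · exact hc.ne p h.symm
    · exact hc.ne q h.symm
  · refine ⟨hc.mem r, ?_⟩
    have hr : t ≤ r := hr
    rintro (h | h)
    · exact absurd (hc.injective h) (by linarith)
    · exact absurd (hc.injective h) (by linarith)

/-- Homotheties centered at a point of a Ptolemy line act on the distance functions to the
points of this line by rescaling. -/
theorem PropertyH.exists_homothetic_point (hH : PropertyH S) (hcomp : MobiusCompact S)
    (hd : d ∈ S.M) (hrem : d.rem = some ω) (hσ : IsPtolemyCircle S σ) (hωσ : ω ∈ σ)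
    (hc : IsUnitSpeed d (σ \ {ω}) c) (q : ℝ) {lam : ℝ} (hlam : 0 < lam) {z : X} (hz : z ≠ ω) :
    ∃ z' : X, z' ≠ ω ∧ ∀ t, d.fd z' (c (q + lam * (t - q))) = lam * d.fd z (c t) := by
  obtain ⟨γ₀, hγ, hγω, hγq, hpres, hγx⟩ := hH ω (c q) (hc.ne q).symm σ hσ hωσ (hc.mem q)
    (c (q - 1)) (c (q - lam))
    ⟨hc.mem _, by
      rintro (h | h)
      · exact hc.ne _ h
      · exact absurd (hc.injective h) (by linarith)⟩
    (hc.mem_mobiusCCIn hcomp hd hrem (by linarith) (by linarith))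
  obtain ⟨γ, rfl⟩ : ∃ γ : X ≃ X, ⇑γ = γ₀ := ⟨Equiv.ofBijective γ₀ hγ.1, rfl⟩
  have hrem' : (d.comap γ).rem = some ω := by
    simp [ExtMetric.comap, hrem, Equiv.symm_apply_eq, hγω]
  obtain ⟨k, hk, hdk⟩ := MobiusStructure.exists_fd_eq hd (hγ.comap_mem hd) hrem
  replace hdk : ∀ x y, x ≠ ω → y ≠ ω → d.fd (γ x) (γ y) = k * d.fd x y := by
    intro x y hx hy
    rw [← ExtMetric.fd_comap, hdk x y hx hy, ExtMetric.fd_rem hrem' hx,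
      ExtMetric.fd_rem hrem' hy, mul_one, mul_one]
  have hk_eq : k = lam := by
    have := hdk (c (q - 1)) (c q) (hc.ne _) (hc.ne _)
    rw [hγx, hγq, hc.fd_eq, hc.fd_eq, sub_sub_cancel_left, sub_sub_cancel_left, abs_neg,
      abs_neg, abs_one, abs_of_pos hlam, mul_one] at this
    exact this.symm
  subst hk_eq
  have hne : ∀ x, x ≠ ω → γ x ≠ ω := fun x hx h => hx (γ.injective (h.trans hγω.symm))
  have hγc : ∀ t, γ (c t) = c (q + k * (t - q)) := by
    intro t
    have hmem : γ (c t) ∈ σ := by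
      have := (hpres σ hσ hωσ (hc.mem q)).1
      rw [← this]
      exact ⟨c t, hc.mem t, rfl⟩
    obtain ⟨r, hr⟩ := hc.exists_eq hmem (hne _ (hc.ne t))
    rw [← hr]
    have h1 := hdk (c t) (c q) (hc.ne _) (hc.ne _)
    have h2 := hdk (c t) (c (q - 1)) (hc.ne _) (hc.ne _)
    rw [hγq, ← hr, hc.fd_eq, hc.fd_eq] at h1
    rw [hγx, ← hr, hc.fd_eq, hc.fd_eq] at h2
    have h1' : (r - q) ^ 2 = (k * (t - q)) ^ 2 := by
      rw [← sq_abs, h1, mul_pow, sq_abs, mul_pow]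
    have h2' : (r - (q - k)) ^ 2 = (k * (t - (q - 1))) ^ 2 := by
      rw [← sq_abs, h2, mul_pow, sq_abs, mul_pow]
    congr 1
    have : 2 * k * (r - (q + k * (t - q))) = 0 := by linear_combination h2' - h1'
    have := (mul_eq_zero.1 this).resolve_left (by positivity)
    linarith
  exact ⟨γ z, hne z hz, fun t => by rw [← hγc, hdk z (c t) hz (hc.ne t)]⟩

end Lines

section DistanceFunctions

variable {X : Type*} {S : MobiusStructure X} {d : ExtMetric X} {ω : X} {σ : Set X} {c : ℝ → X}

theorem IsUnitSpeed.fd_sub_le (hrem : d.rem = some ω) (hc : IsUnitSpeed d (σ \ {ω}) c) {z : X}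
    (hz : z ≠ ω) (s t : ℝ) : d.fd z (c s) - d.fd z (c t) ≤ |s - t| := by
  have := d.fd_triangle hrem hz (hc.ne t) (hc.ne s)
  rw [hc.fd_eq, abs_sub_comm] at this
  linarith

theorem IsUnitSpeed.convexOn_fd (hpt : IsPtolemyStructure S) (hd : d ∈ S.M) {l : Set X}
    (hc : IsUnitSpeed d l c) {z : X} (hz : z ∉ l) :
    ConvexOn ℝ Set.univ fun t => d.fd z (c t) := by
  have hzc : ∀ t, z ≠ c t := fun t h => hz (h ▸ hc.1.subset (Set.mem_range_self t))
  refine LinearOrder.convexOn_of_lt convex_univ fun s _ t _ hst a b ha hb hab => ?_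
  simp only [smul_eq_mul]
  set m := a * s + b * t with hm
  have hsm : m - s = b * (t - s) := by
    rw [hm, eq_sub_of_add_eq hab]; ring
  have hmt : t - m = a * (t - s) := by
    rw [hm, eq_sub_of_add_eq' hab]; ring
  have hpos : 0 < t - s := sub_pos.2 hst
  have h1 : 0 < m - s := hsm ▸ mul_pos hb hpos
  have h2 : 0 < t - m := hmt ▸ mul_pos ha hpos
  have h := (hpt.fd_mul_le hd (x := z) (y := c m) (u := c s) (v := c t) (hzc s)
    (hc.injective.ne (by linarith)) (hc.injective.ne (by linarith))).1
  rw [hc.fd_eq, hc.fd_eq, hc.fd_eq, abs_sub_comm s t, abs_sub_comm m t, abs_of_pos hpos,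
    abs_of_pos h1, abs_of_pos h2, hsm, hmt] at h
  refine le_of_mul_le_mul_right ?_ hpos
  linarith

/-- If the distance function to a point had a corner, homotheties centered on the line would
produce an infinite bounded family of points whose mutual distances, by the Ptolemy inequality,
are bounded away from zero. -/
theorem IsUnitSpeed.differentiable_fd (hpt : IsPtolemyStructure S) (hcomp : MobiusCompact S)
    (hH : PropertyH S) (hd : d ∈ S.M) (hrem : d.rem = some ω) (hσ : IsPtolemyCircle S σ)
    (hωσ : ω ∈ σ) (hc : IsUnitSpeed d (σ \ {ω}) c) {z : X} (hzω : z ≠ ω) (hz : z ∉ σ) :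
    Differentiable ℝ fun t => d.fd z (c t) := by
  intro a
  by_contra hnd
  set f : ℝ → ℝ := fun t => d.fd z (c t) with hf
  have hzc : ∀ t, z ≠ c t := fun t h => hz (h ▸ hc.mem t)
  obtain ⟨α, β, hβα, hα1, hβ1, hα, hβ⟩ := exists_corner_of_convexOn
    (hc.convexOn_fd hpt hd fun h => hz h.1) (hc.fd_sub_le hrem hzω) hnd
  have hF : 0 < f a := d.fd_pos (hzc a)
  set F := f a
  replace hα : ∀ v, 0 ≤ v → F + α * v ≤ f (a + v) := hα
  replace hβ : ∀ v, 0 ≤ v → F - β * v ≤ f (a - v) := hβ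
  set η := min 1 (min F ((α - β) * F / (2 * (2 * F + 1)))) with hη
  have hη0 : 0 < η := by
    have : 0 < α - β := sub_pos.2 hβα
    positivity
  have hη1 : η ≤ 1 := min_le_left _ _
  have hηF : η ≤ F := (min_le_right _ _).trans (min_le_left _ _)
  have hηδ : η * (2 * (2 * F + 1)) ≤ (α - β) * F := by
    rw [← le_div_iff₀ (by positivity)]
    exact (min_le_right _ _).trans (min_le_right _ _)
  let x : ℕ → ℝ := fun n => η / (n + 1)
  have hx0 : ∀ n, 0 < x n := fun n => by positivity
  have hxη : ∀ n, x n ≤ η := fun n => div_le_self hη0.le (by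
    have : (0 : ℝ) ≤ n := n.cast_nonneg
    linarith)
  have hxlt : ∀ {m n}, m < n → x n < x m := fun {m n} h =>
    div_lt_div_of_pos_left hη0 (by positivity) (by
      have : (m : ℝ) < n := Nat.cast_lt.2 h
      linarith)
  choose p hpω hp using fun n => hH.exists_homothetic_point hcomp hd hrem hσ hωσ hc (a + 1)
    (show (0 : ℝ) < 1 + x n by linarith [hx0 n]) hzω
  have hpfd : ∀ n t, d.fd (p n) (c t) = (1 + x n) * f (a + 1 + (t - (a + 1)) / (1 + x n)) := by
    intro n t
    have : 1 + x n ≠ 0 := by linarith [hx0 n]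
    rw [hf]
    dsimp only
    rw [← hp n]
    congr 2
    field_simp
    ring
  have hpc : ∀ n t, p n ≠ c t := by
    intro n t h
    have := hpfd n t
    rw [h, d.fd_self] at this
    exact absurd this (mul_pos (by linarith [hx0 n]) (d.fd_pos (hzc _))).ne
  obtain ⟨m, n, hmn, hlt⟩ := exists_lt_dist_lt hcomp hd hrem (p := p) (hc.ne (a + 1))
    (R := ENNReal.ofReal (2 * f (a + 1))) ENNReal.ofReal_ne_top (fun n => by
      rw [← ExtMetric.ofReal_fd (ExtMetric.ne_top_of_ne_rem hrem (hpω n) (hc.ne _))]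
      refine ENNReal.ofReal_le_ofReal ?_
      rw [hpfd, sub_self, zero_div, add_zero]
      exact mul_le_mul_of_nonneg_right (by linarith [hxη n]) (d.fd_nonneg _ _))
    (δ := ENNReal.ofReal ((α - β) * F / 2))
    (ENNReal.ofReal_pos.2 (by have := mul_pos (sub_pos.2 hβα) hF; linarith))
    ENNReal.ofReal_ne_top
  rw [← ExtMetric.ofReal_fd (ExtMetric.ne_top_of_ne_rem hrem (hpω m) (hpω n)),
    ENNReal.ofReal_lt_ofReal_iff (by have := mul_pos (sub_pos.2 hβα) hF; linarith)] at hlt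
  have hxy := hxlt hmn
  have hy0 := hx0 n
  have hxη' := hxη m
  have hm := hpfd m
  have hn := hpfd n
  generalize x m = X₁ at hxy hxη' hm
  generalize x n = X₂ at hxy hy0 hn
  set h := X₁ - X₂ with hh
  have hh0 : 0 < h := sub_pos.2 hxy
  have hl1 : (0 : ℝ) < 1 + X₁ := by linarith
  have hl2 : (0 : ℝ) < 1 + X₂ := by linarith
  have e1 : d.fd (p m) (c (a - X₁)) = (1 + X₁) * F := by
    rw [hm]
    congr 2
    field_simp
    ring
  have e2 : d.fd (p n) (c (a - X₂)) = (1 + X₂) * F := by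
    rw [hn]
    congr 2
    field_simp
    ring
  have e3 : (1 + X₁) * F + α * h ≤ d.fd (p m) (c (a - X₂)) := by
    have hv := hα (h / (1 + X₁)) (by positivity)
    have heq : a + 1 + (a - X₂ - (a + 1)) / (1 + X₁) = a + h / (1 + X₁) := by
      rw [hh]
      field_simp
      ring
    rw [hm, heq]
    refine le_trans (le_of_eq ?_) (mul_le_mul_of_nonneg_left hv hl1.le)
    field_simp
  have e4 : (1 + X₂) * F - β * h ≤ d.fd (p n) (c (a - X₁)) := by
    have hv := hβ (h / (1 + X₂)) (by positivity)
    have heq : a + 1 + (a - X₁ - (a + 1)) / (1 + X₂) = a - h / (1 + X₂) := by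
      rw [hh]
      field_simp
      ring
    rw [hn, heq]
    refine le_trans (le_of_eq ?_) (mul_le_mul_of_nonneg_left hv hl2.le)
    field_simp
  have hpto := (hpt.fd_mul_le hd (x := p m) (y := p n) (u := c (a - X₂)) (v := c (a - X₁))
    (hpc m _) (hpc n _) (hpc n _)).2
  rw [e1, e2, hc.fd_eq, show a - X₂ - (a - X₁) = h by rw [hh]; ring, abs_of_pos hh0] at hpto
  have hβh : β * h ≤ F := by nlinarith
  have hB : 0 ≤ (1 + X₂) * F - β * h := by nlinarith
  have hprod : ((1 + X₁) * F + α * h) * ((1 + X₂) * F - β * h) ≤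
      d.fd (p m) (c (a - X₂)) * d.fd (p n) (c (a - X₁)) :=
    (mul_le_mul_of_nonneg_right e3 hB).trans (mul_le_mul_of_nonneg_left e4 (d.fd_nonneg _ _))
  have hmain : (α * (1 + X₂) * F - β * (1 + X₁) * F - α * β * h) * h ≤
      d.fd (p m) (p n) * h := by linarith
  have hmain := le_of_mul_le_mul_right hmain hh0
  have b1 : -(X₂ * F) ≤ α * X₂ * F := by
    have := mul_pos hy0 hF
    nlinarith
  have b2 : β * X₁ * F ≤ X₁ * F := by
    have := mul_pos (hy0.trans hxy) hF
    nlinarith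
  have b3 : α * β * h ≤ h := by
    have := mul_nonneg (sub_nonneg.2 hα1) (neg_le_iff_add_nonneg'.1 hβ1)
    have hαβ : α * β ≤ 1 := by linarith
    nlinarith
  have b4 : X₁ * F ≤ η * F := mul_le_mul_of_nonneg_right hxη' hF.le
  have b5 : X₂ * F ≤ η * F := mul_le_mul_of_nonneg_right (hxy.le.trans hxη') hF.le
  linarith

end DistanceFunctions

section Busemann

variable {X : Type*} {S : MobiusStructure X} {d d' : ExtMetric X} {ω : X} {σ : Set X}
  {c : ℝ → X}

theorem IsUnitSpeed.comp_neg {l : Set X} (hc : IsUnitSpeed d l c) :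
    IsUnitSpeed d l fun t => c (-t) := by
  refine ⟨?_, fun s t => ?_⟩
  · rw [← hc.1]
    exact (Equiv.neg ℝ).surjective.range_comp c
  · rw [hc.2, ← abs_neg]
    congr 2
    ring

theorem IsUnitSpeed.exists_tendsto_busemann (hrem : d.rem = some ω)
    (hc : IsUnitSpeed d (σ \ {ω}) c) {x : X} (hx : x ≠ ω) :
    ∃ b : ℝ, Filter.Tendsto (fun t => d.fd x (c t) - t) Filter.atTop (nhds b) := by
  refine ⟨_, tendsto_atTop_ciInf (fun s t hst => ?_) ⟨-d.fd x (c 0), ?_⟩⟩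
  · have := hc.fd_sub_le hrem hx t s
    rw [abs_of_nonneg (sub_nonneg.2 hst)] at this
    linarith
  · rintro _ ⟨t, rfl⟩
    have := d.fd_triangle hrem (hc.ne 0) hx (hc.ne t)
    rw [hc.fd_eq, d.fd_comm (c 0), zero_sub, abs_neg] at this
    dsimp only
    linarith [le_abs_self t]

theorem PropertyH.exists_mem_rem (hH : PropertyH S) (hcomp : MobiusCompact S)
    (hd : d ∈ S.M) (hrem : d.rem = some ω) (hσ : IsPtolemyCircle S σ) (hωσ : ω ∈ σ)
    (hc : IsUnitSpeed d (σ \ {ω}) c) : ∃ r, ∃ d' ∈ S.M, d'.rem = some (c r) := by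
  have h01 : c 0 ≠ c 1 := hc.injective.ne zero_ne_one
  obtain ⟨γ₀, hγ, -, -, hpres, hγω⟩ := hH (c 0) (c 1) h01 σ hσ (hc.mem 0) (hc.mem 1) ω (c 2)
    ⟨hωσ, by
      rintro (h | h)
      · exact hc.ne _ h.symm
      · exact hc.ne _ h.symm⟩
    (hc.mem_mobiusCCIn_rem hcomp hd hrem hωσ two_pos one_lt_two)
  obtain ⟨γ, rfl⟩ : ∃ γ : X ≃ X, ⇑γ = γ₀ := ⟨Equiv.ofBijective γ₀ hγ.1, rfl⟩
  obtain ⟨y, hyσ, hy⟩ : ω ∈ γ '' σ := (hpres σ hσ (hc.mem 0) (hc.mem 1)).1.symm ▸ hωσ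
  have hyω : y ≠ ω := by
    rintro rfl
    exact hc.ne 2 (hγω.symm.trans hy)
  obtain ⟨r, rfl⟩ := hc.exists_eq hyσ hyω
  refine ⟨r, d.comap γ, hγ.comap_mem hd, ?_⟩
  simp [ExtMetric.comap, hrem, Equiv.symm_apply_eq, hy]

/-- Inversion at a point `c r` of a Ptolemy line turns the distance function to a point `x` into
`u ↦ k * G * |u| * d(x, c(r + k⁻¹ / u))`. -/
theorem IsUnitSpeed.exists_inversion (hd : d ∈ S.M) (hrem : d.rem = some ω) (hωσ : ω ∈ σ)
    (hc : IsUnitSpeed d (σ \ {ω}) c) {r : ℝ} (hd' : d' ∈ S.M) (hrem' : d'.rem = some (c r)) :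
    ∃ k : ℝ, 0 < k ∧ ∃ c' : ℝ → X, c' 0 = ω ∧ IsUnitSpeed d' (σ \ {c r}) c' ∧
      ∀ x, x ≠ ω → ∀ u, u ≠ 0 →
        d'.fd x (c' u) = k * d'.fd x ω * |u| * d.fd x (c (r + k⁻¹ / u)) := by
  obtain ⟨k, hk, hkd⟩ := MobiusStructure.exists_fd_eq hd hd' hrem
  have hrω : c r ≠ ω := hc.ne r
  have hω : ∀ u, u ≠ 0 → d'.fd (c (r + k⁻¹ / u)) ω = |u| := by
    intro u hu
    have hne : c (r + k⁻¹ / u) ≠ c r := by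
      refine hc.injective.ne ?_
      rw [Ne, add_eq_left]
      positivity
    have h := hkd _ _ (hc.ne (r + k⁻¹ / u)) hrω
    rw [ExtMetric.fd_rem hrem' hne, d'.fd_comm (c r), ExtMetric.fd_rem hrem' hrω.symm, hc.fd_eq,
      add_sub_cancel_left, abs_div, abs_of_pos (inv_pos.2 hk)] at h
    have hu' : |u| ≠ 0 := abs_ne_zero.2 hu
    generalize d'.fd (c (r + k⁻¹ / u)) ω = a at h ⊢
    field_simp at h
    exact h.symm
  let c' : ℝ → X := fun u => if u = 0 then ω else c (r + k⁻¹ / u)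
  have hc'0 : c' 0 = ω := if_pos rfl
  have hc' : ∀ u, u ≠ 0 → c' u = c (r + k⁻¹ / u) := fun u hu => if_neg hu
  have hc'ω : ∀ u, d'.fd (c' u) ω = |u| := by
    intro u
    by_cases hu : u = 0
    · rw [hu, hc'0, d'.fd_self, abs_zero]
    · rw [hc' u hu, hω u hu]
  have hc'r : ∀ u, c' u ≠ c r := by
    intro u
    by_cases hu : u = 0
    · rw [hu, hc'0]
      exact hrω.symm
    · rw [hc' u hu]
      refine hc.injective.ne ?_
      rw [Ne, add_eq_left]
      positivity
  have hform : ∀ x, x ≠ ω → ∀ u, u ≠ 0 →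
      d'.fd x (c' u) = k * d'.fd x ω * |u| * d.fd x (c (r + k⁻¹ / u)) := by
    intro x hx u hu
    rw [hc' u hu, hkd x _ hx (hc.ne _), hω u hu]
  refine ⟨k, hk, c', hc'0, ⟨?_, fun s t => ?_⟩, hform⟩
  · refine Set.Subset.antisymm ?_ ?_
    · rintro _ ⟨u, rfl⟩
      refine ⟨?_, hc'r u⟩
      by_cases hu : u = 0
      · rw [hu, hc'0]
        exact hωσ
      · rw [hc' u hu]
        exact hc.mem _
    · rintro y ⟨hy, hyr⟩
      by_cases hyω : y = ω
      · exact ⟨0, hc'0.trans hyω.symm⟩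
      · obtain ⟨t, rfl⟩ := hc.exists_eq hy hyω
        have htr : t - r ≠ 0 := fun h => hyr (by rw [sub_eq_zero.1 h]; rfl)
        refine ⟨k⁻¹ / (t - r), ?_⟩
        rw [hc' _ (by positivity)]
        congr 1
        field_simp
        ring
  · rw [← ExtMetric.ofReal_fd (ExtMetric.ne_top_of_ne_rem hrem' (hc'r s) (hc'r t))]
    congr 1
    by_cases ht : t = 0
    · rw [ht, hc'0, hc'ω, sub_zero]
    by_cases hs : s = 0
    · rw [hs, hc'0, d'.fd_comm, hc'ω, zero_sub, abs_neg]
    rw [hform _ (by rw [hc' s hs]; exact hc.ne _) t ht, hc'ω, hc' s hs, hc.fd_eq,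
      ← abs_of_pos hk, ← abs_mul, ← abs_mul, ← abs_mul, abs_of_pos hk, abs_sub_comm s t]
    congr 1
    field_simp
    ring

theorem IsUnitSpeed.busemann_add_eq_zero (hpt : IsPtolemyStructure S)
    (hcomp : MobiusCompact S) (hH : PropertyH S) (hd : d ∈ S.M) (hrem : d.rem = some ω)
    (hσ : IsPtolemyCircle S σ) (hωσ : ω ∈ σ) (hc : IsUnitSpeed d (σ \ {ω}) c) {x : X}
    (hxω : x ≠ ω) (hx : x ∉ σ) {bp bm : ℝ}
    (hbp : Filter.Tendsto (fun t => d.fd x (c t) - t) Filter.atTop (nhds bp))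
    (hbm : Filter.Tendsto (fun t => d.fd x (c (-t)) - t) Filter.atTop (nhds bm)) :
    bp + bm = 0 := by
  obtain ⟨r, d', hd', hrem'⟩ := hH.exists_mem_rem hcomp hd hrem hσ hωσ hc
  obtain ⟨k, hk, c', hc'0, hc', hform⟩ := hc.exists_inversion hd hrem hωσ hd' hrem'
  have hxr : x ≠ c r := fun h => hx (h ▸ hc.mem r)
  have hdiff := hc'.differentiable_fd hpt hcomp hH hd' hrem' hσ (hc.mem r) hxr hx 0
  have hslope := hdiff.hasDerivAt.tendsto_slope
  set L := deriv (fun t => d'.fd x (c' t)) 0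
  set G := d'.fd x ω
  have hG : 0 < G := d'.fd_pos hxω
  have hs : ∀ u, u ≠ 0 → slope (fun t => d'.fd x (c' t)) 0 u =
      (k * G * |u| * d.fd x (c (r + k⁻¹ / u)) - G) / u := by
    intro u hu
    rw [slope_def_field, hform x hxω u hu, hc'0, sub_zero]
  have htop : Filter.Tendsto (fun t : ℝ => k⁻¹ / (t - r)) Filter.atTop (nhdsWithin 0 {0}ᶜ) := by
    refine tendsto_nhdsWithin_iff.2 ⟨?_, ?_⟩
    · exact Filter.Tendsto.const_div_atTop
        (Filter.tendsto_atTop_add_const_right _ _ Filter.tendsto_id) _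
    · filter_upwards [Filter.eventually_gt_atTop r] with t ht
      have : t - r ≠ 0 := (sub_pos.2 ht).ne'
      exact (by positivity : k⁻¹ / (t - r) ≠ 0)
  have hbot : Filter.Tendsto (fun t : ℝ => k⁻¹ / (-t - r)) Filter.atTop
      (nhdsWithin 0 {0}ᶜ) := by
    refine tendsto_nhdsWithin_iff.2 ⟨?_, ?_⟩
    · exact Filter.Tendsto.const_div_atBot
        (Filter.tendsto_atBot_add_const_right _ _ Filter.tendsto_neg_atTop_atBot) _
    · filter_upwards [Filter.eventually_gt_atTop (-r)] with t ht
      have : -t - r ≠ 0 := by linarith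
      exact (by positivity : k⁻¹ / (-t - r) ≠ 0)
  have hplus : L = k * G * (bp + r) := by
    refine tendsto_nhds_unique (hslope.comp htop)
      (((hbp.add_const r).const_mul (k * G)).congr' ?_)
    filter_upwards [Filter.eventually_gt_atTop r] with t ht
    have hpos : 0 < t - r := sub_pos.2 ht
    have harg : r + k⁻¹ / (k⁻¹ / (t - r)) = t := by
      field_simp
      ring
    rw [Function.comp_apply, hs _ (by positivity), harg, abs_of_pos (by positivity)]
    field_simp
    ring
  have hminus : L = -(k * G * (bm - r)) := by
    refine tendsto_nhds_unique (hslope.comp hbot)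
      ((((hbm.sub_const r).const_mul (k * G)).neg).congr' ?_)
    filter_upwards [Filter.eventually_gt_atTop (-r)] with t ht
    have hneg : -t - r < 0 := by linarith
    have hne : -t - r ≠ 0 := hneg.ne
    have harg : r + k⁻¹ / (k⁻¹ / (-t - r)) = -t := by
      field_simp
      ring
    rw [Function.comp_apply, hs _ (by positivity), harg,
      abs_of_neg (div_neg_of_pos_of_neg (by positivity) hneg)]
    field_simp
    ring
  have hsum : k * G * (bp + bm) = 0 := by linear_combination hminus - hplus
  exact (mul_eq_zero.1 hsum).resolve_left (by positivity)

end Busemann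

/-- Lemma 6.2 / Proposition 3.4 of the paper.  Let `X` be a compact
Ptolemy space with the homothety property (H).  Then for every `ω ∈ X`, every point
`z ∈ X_ω` and every Ptolemy line `l ⊆ X_ω` with `z ∉ l` and unit-speed parameterization
`c`, the function `t ↦ d(z,c(t))` is convex and continuously differentiable.
Consequently `X` is Busemann flat: the opposite Busemann functions
`b⁺(x) = lim_{t→∞}(d(x,c(t)) − t)` and `b⁻(x) = lim_{t→∞}(d(x,c(−t)) − t)` of any
Ptolemy line satisfy `b⁺(x) + b⁻(x) = 0` for all `x ∈ X_ω`. -/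
theorem stmt_9 {X : Type*} (S : MobiusStructure X)
    (hpt : IsPtolemyStructure S) (hcomp : MobiusCompact S) (hH : PropertyH S)
    (ω : X) (d : ExtMetric X) (hd : d ∈ S.M) (hrem : d.rem = some ω) :
    (∀ z : X, z ≠ ω → ∀ l : Set X, IsPtolemyLine S ω l → z ∉ l →
      ∀ c : ℝ → X, IsUnitSpeed d l c →
        ConvexOn ℝ Set.univ (fun t => (d.d z (c t)).toReal) ∧
        ContDiff ℝ 1 (fun t => (d.d z (c t)).toReal)) ∧
    (∀ l : Set X, IsPtolemyLine S ω l → ∀ c : ℝ → X, IsUnitSpeed d l c →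
      ∀ x : X, x ≠ ω → ∃ bp bm : ℝ,
        Filter.Tendsto (fun t => (d.d x (c t)).toReal - t) Filter.atTop (nhds bp) ∧
        Filter.Tendsto (fun t => (d.d x (c (-t))).toReal - t) Filter.atTop (nhds bm) ∧
        bp + bm = 0) := by
  refine ⟨?_, ?_⟩
  · rintro z hz _ ⟨σ, hσ, hωσ, rfl⟩ hzl c hc
    have hzσ : z ∉ σ := fun h => hzl ⟨h, hz⟩
    have hfd : (fun t => (d.d z (c t)).toReal) = fun t => d.fd z (c t) := funext fun t =>
      (ExtMetric.fd_eq_toReal (ExtMetric.ne_top_of_ne_rem hrem hz (hc.ne t))).symm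
    rw [hfd]
    have hconv := hc.convexOn_fd hpt hd hzl
    exact ⟨hconv, contDiff_one_of_convexOn hconv
      (hc.differentiable_fd hpt hcomp hH hd hrem hσ hωσ hz hzσ)⟩
  · rintro _ ⟨σ, hσ, hωσ, rfl⟩ c hc x hx
    have hfd : ∀ t, (d.d x (c t)).toReal = d.fd x (c t) := fun t =>
      (ExtMetric.fd_eq_toReal (ExtMetric.ne_top_of_ne_rem hrem hx (hc.ne t))).symm
    simp only [hfd]
    obtain ⟨bp, hbp⟩ := hc.exists_tendsto_busemann hrem hx
    obtain ⟨bm, hbm⟩ := hc.comp_neg.exists_tendsto_busemann hrem hx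
    refine ⟨bp, bm, hbp, hbm, ?_⟩
    by_cases hxσ : x ∈ σ
    · obtain ⟨r, rfl⟩ := hc.exists_eq hxσ hx
      have hp : bp = -r := by
        refine tendsto_nhds_unique hbp (tendsto_const_nhds.congr' ?_)
        filter_upwards [Filter.eventually_ge_atTop r] with t ht
        rw [hc.fd_eq, abs_of_nonpos (by linarith)]
        ring
      have hm : bm = r := by
        refine tendsto_nhds_unique hbm (tendsto_const_nhds.congr' ?_)
        filter_upwards [Filter.eventually_ge_atTop (-r)] with t ht
        rw [hc.fd_eq, abs_of_nonneg (by linarith)]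
        ring
      rw [hp, hm, neg_add_cancel]
    · exact hc.busemann_add_eq_zero hpt hcomp hH hd hrem hσ hωσ hx hxσ hbp hbm

end Mobius
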